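/- For every j ∈ {1,…,p}, setting v_j := (τ̃_{j,♯}²/τ̂_{j,♯})·XΘ̂_{j,♯} ∈ ℝⁿ (a vector depending only on X and λ̲), one has ‖v_j‖_n = 1 and the de-sparsified Lasso b̂_♯ satisfies the exact decomposition (τ̃_{j,♯}²/τ̂_{j,♯})·(b̂_{j,♯} − β⁰_j) = v_jᵀε/n + rem_j, where the remainder satisfies |rem_j| ≤ λ̲‖β̂ − β⁰‖₁ for every j (i.e. ‖rem‖_∞ ≤ λ̲‖β̂ − β⁰‖₁). -/

import Mathlib

open Finset Matrix

/-- `‖v‖_n = √(vᵀv/n)`. -/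
noncomputable def normN {n : ℕ} (v : Fin n → ℝ) : ℝ :=
  Real.sqrt ((∑ i, v i ^ 2) / n)

/-- `ℓ₁`-norm of a vector. -/
noncomputable def l1norm {p : ℕ} (v : Fin p → ℝ) : ℝ := ∑ j, |v j|

/-- `ℓ_∞`-norm of a vector. -/
noncomputable def lsup {p : ℕ} (v : Fin p → ℝ) : ℝ := ⨆ j, |v j|

/-- `β_S`: the vector `β` with entries outside `S` set to zero. -/
def sub0 {p : ℕ} (S : Finset (Fin p)) (β : Fin p → ℝ) : Fin p → ℝ :=
  fun j => if j ∈ S then β j else 0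

/-- The compatibility constant squared `φ̂²(L,S)`. -/
noncomputable def compatSq {n p : ℕ} (X : Matrix (Fin n) (Fin p) ℝ) (L : ℝ)
    (S : Finset (Fin p)) : ℝ :=
  sInf { r | ∃ β : Fin p → ℝ, l1norm (sub0 S β) = 1 ∧ l1norm (sub0 Sᶜ β) ≤ L ∧
    r = S.card * (normN (X.mulVec (sub0 S β) - X.mulVec (sub0 Sᶜ β))) ^ 2 }

theorem nonpos_of_forall_mul_le_sq_mul {a b : ℝ}
    (h : ∀ t : ℝ, 0 < t → t ≤ 1 → t * a ≤ t ^ 2 * b) : a ≤ 0 := by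
  by_contra! ha
  have hb : 0 < |b| + a := by positivity
  have ht : 0 < a / (2 * (|b| + a)) := by positivity
  have ht1 : a / (2 * (|b| + a)) ≤ 1 := by
    rw [div_le_one (by positivity)]
    linarith [abs_nonneg b]
  have h1 := h _ ht ht1
  have h2 : a ≤ a / (2 * (|b| + a)) * b := by
    refine le_of_mul_le_mul_left ?_ ht
    linarith
  have h3 : a / (2 * (|b| + a)) * b ≤ a / (2 * (|b| + a)) * (|b| + a) := by
    gcongr
    linarith [le_abs_self b]
  have h4 : a / (2 * (|b| + a)) * (|b| + a) = a / 2 := by field_simp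
  linarith

theorem normN_sq {n : ℕ} (v : Fin n → ℝ) : normN v ^ 2 = v ⬝ᵥ v / n := by
  unfold normN
  rw [Real.sq_sqrt (by positivity)]
  simp [dotProduct, sq]

theorem normN_nonneg {n : ℕ} (v : Fin n → ℝ) : 0 ≤ normN v := Real.sqrt_nonneg _

theorem normN_smul {n : ℕ} (c : ℝ) (v : Fin n → ℝ) : normN (c • v) = |c| * normN v := by
  rw [← sq_eq_sq₀ (normN_nonneg _) (mul_nonneg (abs_nonneg _) (normN_nonneg _)), mul_pow,
    normN_sq, normN_sq, sq_abs, smul_dotProduct, dotProduct_smul]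
  simp only [smul_eq_mul]
  ring

theorem l1norm_smul {p : ℕ} (c : ℝ) (v : Fin p → ℝ) : l1norm (c • v) = |c| * l1norm v := by
  simp [l1norm, abs_mul, mul_sum]

theorem l1norm_add_le {p : ℕ} (v w : Fin p → ℝ) : l1norm (v + w) ≤ l1norm v + l1norm w := by
  unfold l1norm
  rw [← sum_add_distrib]
  exact sum_le_sum fun i _ => abs_add_le _ _

theorem l1norm_single {p : ℕ} (k : Fin p) (c : ℝ) : l1norm (Pi.single k c) = |c| := by
  unfold l1norm
  rw [sum_eq_single k] <;> simp +contextual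

/-- Tangent-line bound for the norm along a line. -/
theorem normN_sub_smul_le {n : ℕ} {r : Fin n → ℝ} (hr : 0 < normN r) (w : Fin n → ℝ) (t : ℝ) :
    normN (r - t • w) ≤
      normN r - t * (r ⬝ᵥ w / n) / normN r + t ^ 2 * (w ⬝ᵥ w / n / (2 * normN r)) := by
  have h : normN (r - t • w) ^ 2 =
      normN r ^ 2 - 2 * t * (r ⬝ᵥ w / n) + t ^ 2 * (w ⬝ᵥ w / n) := by
    rw [normN_sq, normN_sq]
    simp only [sub_dotProduct, dotProduct_sub, smul_dotProduct, dotProduct_smul, smul_eq_mul,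
      dotProduct_comm w r]
    ring
  have h2 : normN r - t * (r ⬝ᵥ w / n) / normN r + t ^ 2 * (w ⬝ᵥ w / n / (2 * normN r)) =
      (normN r ^ 2 + normN (r - t • w) ^ 2) / (2 * normN r) := by
    rw [h]
    field_simp
    ring
  rw [h2, le_div_iff₀ (by positivity)]
  nlinarith [sq_nonneg (normN r - normN (r - t • w))]

/-- First-order optimality of the square-root Lasso in the direction `u`, along which the
`ℓ₁`-norm grows with slope at most `s`. -/
theorem sqrtLasso_directional {n p : ℕ} {X : Matrix (Fin n) (Fin p) ℝ} {y : Fin n → ℝ}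
    {lam : ℝ} (hlam : 0 < lam) {γ u : Fin p → ℝ} {s : ℝ} (hr : 0 < normN (y - X.mulVec γ))
    (hmin : ∀ t : ℝ, normN (y - X.mulVec γ) + lam * l1norm γ ≤
      normN (y - X.mulVec (γ + t • u)) + lam * l1norm (γ + t • u))
    (hs : ∀ t : ℝ, 0 < t → t ≤ 1 → l1norm (γ + t • u) ≤ l1norm γ + t * s) :
    (y - X.mulVec γ) ⬝ᵥ X.mulVec u / n / normN (y - X.mulVec γ) ≤ lam * s := by
  refine sub_nonpos.1 (nonpos_of_forall_mul_le_sq_mul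
    (b := X.mulVec u ⬝ᵥ X.mulVec u / n / (2 * normN (y - X.mulVec γ))) fun t ht ht1 => ?_)
  have h1 := hmin t
  have h2 := normN_sub_smul_le hr (X.mulVec u) t
  have h3 := mul_le_mul_of_nonneg_left (hs t ht ht1) hlam.le
  rw [mulVec_add, mulVec_smul, ← sub_sub] at h1
  rw [mul_div_assoc] at h2
  linarith

theorem desparsified_lasso_linear
    {n p : ℕ} (X : Matrix (Fin n) (Fin p) ℝ) (Y : Fin n → ℝ)
    (β0 : Fin p → ℝ) (ε : Fin n → ℝ) (hε : ε = Y - X.mulVec β0)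
    (Sighat : Matrix (Fin p) (Fin p) ℝ) (hSighat : Sighat = (n : ℝ)⁻¹ • (Xᵀ * X))
    (βhat : Fin p → ℝ)
    (lamu : ℝ) (hlamu : 0 < lamu)
    -- the square-root node-wise Lasso for each node j
    (γhat : Fin p → Fin p → ℝ) (hγhat0 : ∀ j, γhat j j = 0)
    (hγhat : ∀ j, ∀ γ : Fin p → ℝ, γ j = 0 →
      normN ((fun i => X i j) - X.mulVec (γhat j)) + lamu * l1norm (γhat j) ≤
        normN ((fun i => X i j) - X.mulVec γ) + lamu * l1norm γ)
    (τhat : Fin p → ℝ) (hτhat : ∀ j, τhat j = normN ((fun i => X i j) - X.mulVec (γhat j)))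
    (hτhat0 : ∀ j, τhat j ≠ 0)
    (τtsq : Fin p → ℝ)
    (hτtsq : ∀ j, τtsq j = (τhat j) ^ 2 + lamu * τhat j * l1norm (γhat j))
    (Θ : Matrix (Fin p) (Fin p) ℝ)
    (hΘ : ∀ k j, Θ k j = if k = j then 1 / τtsq j else -γhat j k / τtsq j)
    -- the de-sparsified Lasso
    (bhat : Fin p → ℝ)
    (hbhat : bhat = βhat + (n : ℝ)⁻¹ • Θᵀ.mulVec (Xᵀ.mulVec (Y - X.mulVec βhat)))
    (v : Fin p → Fin n → ℝ)
    (hv : ∀ j, v j = (τtsq j / τhat j) • X.mulVec (fun k => Θ k j)) :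
    ∀ j : Fin p,
      normN (v j) = 1 ∧
        |(τtsq j / τhat j) * (bhat j - β0 j) - v j ⬝ᵥ ε / n| ≤
          lamu * l1norm (βhat - β0) := by
  intro j
  set r : Fin n → ℝ := (fun i => X i j) - X.mulVec (γhat j) with hr
  have hτ : τhat j = normN r := hτhat j
  have hpos : 0 < normN r := lt_of_le_of_ne (normN_nonneg _) (hτ ▸ (hτhat0 j).symm)
  have hl1 : 0 ≤ l1norm (γhat j) := sum_nonneg fun _ _ => abs_nonneg _
  have hτt : 0 < τtsq j := by rw [hτtsq, hτ]; positivity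
  have hγj := hγhat0 j
  have hdir (u : Fin p → ℝ) (s : ℝ) (hu : u j = 0)
      (hs : ∀ t : ℝ, 0 < t → t ≤ 1 → l1norm (γhat j + t • u) ≤ l1norm (γhat j) + t * s) :
      r ⬝ᵥ X.mulVec u / n / normN r ≤ lamu * s :=
    sqrtLasso_directional hlamu hpos (fun t => hγhat j _ (by simp [hu, hγj])) hs
  have hcol (k : Fin p) (hk : k ≠ j) : |r ⬝ᵥ X.col k / n / normN r| ≤ lamu := by
    have h (c : ℝ) (hc : |c| = 1) : r ⬝ᵥ X.mulVec (Pi.single k c) / n / normN r ≤ lamu * 1 := by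
      refine hdir _ _ (by simp [hk.symm]) fun t ht _ => (l1norm_add_le _ _).trans ?_
      rw [l1norm_smul, l1norm_single, hc, abs_of_pos ht]
    have h1 := h 1 (by simp)
    have h2 := h (-1) (by simp)
    simp only [mulVec_single, MulOpposite.op_neg, MulOpposite.op_one, neg_smul, one_smul,
      dotProduct_neg, neg_div] at h1 h2
    rw [abs_le]
    constructor <;> linarith
  have hγ : r ⬝ᵥ X.mulVec (γhat j) / n / normN r = lamu * l1norm (γhat j) := by
    have hscale (t : ℝ) (ht : 0 ≤ 1 + t) :
        l1norm (γhat j + t • γhat j) = l1norm (γhat j) + t * l1norm (γhat j) := by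
      rw [show γhat j + t • γhat j = (1 + t) • γhat j by rw [add_smul, one_smul], l1norm_smul,
        abs_of_nonneg ht]
      ring
    have h1 := hdir (γhat j) (l1norm (γhat j)) hγj fun t ht _ => (hscale t (by linarith)).le
    have h2 := hdir (-γhat j) (-l1norm (γhat j)) (by simp [hγj]) fun t ht ht1 => by
      rw [smul_neg, ← neg_smul, hscale (-t) (by linarith)]
      linarith
    simp only [mulVec_neg, dotProduct_neg, neg_div] at h2
    linarith
  have hdiag : r ⬝ᵥ X.col j / n / normN r = τtsq j / τhat j := by
    have h : r ⬝ᵥ X.col j = r ⬝ᵥ r + r ⬝ᵥ X.mulVec (γhat j) := by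
      rw [← dotProduct_add]
      congr 1
      rw [hr, sub_add_cancel]
      rfl
    rw [h, add_div, add_div, hγ, ← normN_sq, hτtsq, hτ]
    field_simp
  have hΘj : (fun k => Θ k j) = (τtsq j)⁻¹ • (Pi.single j 1 - γhat j) := by
    ext k
    rcases eq_or_ne k j with rfl | hk
    · simp [hΘ, hγj]
    · simp [hΘ, hk, div_eq_inv_mul]
  have hvj : v j = (normN r)⁻¹ • r := by
    rw [hv, hΘj, mulVec_smul, smul_smul, mulVec_sub, mulVec_single_one, hτ]
    congr 1
    field_simp
  refine ⟨by rw [hvj, normN_smul, abs_of_pos (inv_pos.2 hpos), inv_mul_cancel₀ hpos.ne'], ?_⟩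
  set d := βhat - β0 with hd
  have hb : τtsq j / τhat j * (bhat j - β0 j) =
      τtsq j / τhat j * d j + v j ⬝ᵥ (ε - X.mulVec d) / n := by
    have hres : Y - X.mulVec βhat = ε - X.mulVec d := by
      rw [hε, hd, mulVec_sub]
      abel
    have hcorr : Θᵀ.mulVec (Xᵀ.mulVec (ε - X.mulVec d)) j =
        X.mulVec (fun k => Θ k j) ⬝ᵥ (ε - X.mulVec d) := by
      rw [mulVec_transpose X, dotProduct_comm (X.mulVec _), dotProduct_mulVec, dotProduct_comm]
      rfl
    rw [hbhat, hres, hv]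
    simp only [Pi.add_apply, Pi.smul_apply, hcorr, smul_dotProduct, smul_eq_mul,
      show d j = βhat j - β0 j from rfl]
    ring
  have hXd : v j ⬝ᵥ X.mulVec d / n = ∑ k, r ⬝ᵥ X.col k / n / normN r * d k := by
    rw [hvj, smul_dotProduct, dotProduct_mulVec, dotProduct, smul_eq_mul, mul_sum, sum_div]
    refine sum_congr rfl fun k _ => ?_
    change (normN r)⁻¹ * (r ⬝ᵥ X.col k * d k) / n = _
    ring
  have hrem : τtsq j / τhat j * (bhat j - β0 j) - v j ⬝ᵥ ε / n =
      -∑ k ∈ univ.erase j, r ⬝ᵥ X.col k / n / normN r * d k := by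
    rw [hb, dotProduct_sub, sub_div, hXd, ← add_sum_erase _ _ (mem_univ j), hdiag]
    ring
  rw [hrem, abs_neg, l1norm, mul_sum]
  calc _ ≤ ∑ k ∈ univ.erase j, |r ⬝ᵥ X.col k / n / normN r * d k| := abs_sum_le_sum_abs _ _
    _ ≤ ∑ k ∈ univ.erase j, lamu * |d k| := by
      refine sum_le_sum fun k hk => ?_
      rw [abs_mul]
      exact mul_le_mul_of_nonneg_right (hcol k (ne_of_mem_erase hk)) (abs_nonneg _)
    _ ≤ _ := sum_le_sum_of_subset_of_nonneg (erase_subset _ _) fun _ _ _ => by positivity
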